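/- Let F : [0,T]×ℝ → ℝ be continuous, with at most polynomial growth in x uniformly in t, solving the backward heat equation ∂_t F + (1/2)∂_{xx}F = 0 with terminal condition F(T,·) = F_T. Then F(t,·) = R_{T−t} * F_T for all t ∈ [0,T), i.e., F(t,x) = ∫ F_T(x+z) R_{T−t}(z) dz, where R_s is the centered Gaussian density of variance s. In particular F(0,·) = R_T * F_T. -/

import Mathlib

open MeasureTheory ProbabilityTheory

/-- Classical solutions of the backward heat equation `∂_t F + (1/2)∂_{xx}F = 0` on
`[0,T) × ℝ`, continuous up to the terminal time. -/
structure IsBackwardHeatSolution (T : ℝ) (F : ℝ → ℝ → ℝ) : Prop where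
  continuous : Continuous (fun p : ℝ × ℝ => F p.1 p.2)
  pde : ∃ Ft Fx Fxx : ℝ → ℝ → ℝ, ∀ t ∈ Set.Ico 0 T, ∀ x : ℝ,
    HasDerivAt (fun s => F s x) (Ft t x) t ∧ HasDerivAt (fun y => F t y) (Fx t x) x ∧
    HasDerivAt (fun y => Fx t y) (Fxx t x) x ∧ Ft t x + (1/2) * Fxx t x = 0

namespace IsBackwardHeatSolution

variable {T : ℝ} {F G : ℝ → ℝ → ℝ}

theorem add (hF : IsBackwardHeatSolution T F) (hG : IsBackwardHeatSolution T G) :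
    IsBackwardHeatSolution T (fun t x => F t x + G t x) := by
  obtain ⟨Ft, Fx, Fxx, h⟩ := hF.pde
  obtain ⟨Gt, Gx, Gxx, k⟩ := hG.pde
  refine ⟨hF.continuous.add hG.continuous, fun t x => Ft t x + Gt t x,
    fun t x => Fx t x + Gx t x, fun t x => Fxx t x + Gxx t x, fun t ht x => ?_⟩
  obtain ⟨h1, h2, h3, h4⟩ := h t ht x
  obtain ⟨k1, k2, k3, k4⟩ := k t ht x
  exact ⟨h1.add k1, h2.add k2, h3.add k3, by linarith⟩

theorem const_mul (hF : IsBackwardHeatSolution T F) (a : ℝ) :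
    IsBackwardHeatSolution T (fun t x => a * F t x) := by
  obtain ⟨Ft, Fx, Fxx, h⟩ := hF.pde
  refine ⟨hF.continuous.const_mul a, fun t x => a * Ft t x,
    fun t x => a * Fx t x, fun t x => a * Fxx t x, fun t ht x => ?_⟩
  obtain ⟨h1, h2, h3, h4⟩ := h t ht x
  exact ⟨h1.const_mul a, h2.const_mul a, h3.const_mul a, by linear_combination a * h4⟩

end IsBackwardHeatSolution

theorem IsLocalMax.secondDeriv_nonpos {f f' : ℝ → ℝ} {f'' x : ℝ} (hmax : IsLocalMax f x)
    (hf : ∀ y, HasDerivAt f (f' y) y) (hf' : HasDerivAt f' f'' x) : f'' ≤ 0 := by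
  by_contra! hpos
  have hd : deriv f = f' := funext fun y => (hf y).deriv
  have hmin : IsLocalMin f x := isLocalMin_of_deriv_deriv_pos (by rwa [hd, hf'.deriv])
    (hmax.deriv_eq_zero) (hf x).continuousAt
  have hconst : f =ᶠ[nhds x] fun _ => f x := by
    filter_upwards [hmax, hmin] with y h1 h2 using le_antisymm h1 h2
  have h0 : f' =ᶠ[nhds x] fun _ => 0 := by
    have := hconst.deriv
    rw [hd] at this
    simpa using this
  have := (hf'.congr_of_eventuallyEq h0.symm).unique (hasDerivAt_const x (0 : ℝ))
  linarith

theorem HasDerivAt.nonpos_of_le_right {f : ℝ → ℝ} {f' t T : ℝ} (htT : t < T)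
    (hf : HasDerivAt f f' t) (hle : ∀ s ∈ Set.Icc t T, f s ≤ f t) : f' ≤ 0 := by
  refine le_of_tendsto hf.tendsto_slope_zero_right ?_
  filter_upwards [Ioo_mem_nhdsGT (sub_pos.2 htT)] with s hs
  have := hle (t + s) ⟨by linarith [hs.1], by linarith [hs.2]⟩
  exact mul_nonpos_of_nonneg_of_nonpos (inv_nonneg.2 hs.1.le) (by linarith)

theorem half_exp_abs_le_cosh (x : ℝ) : Real.exp |x| / 2 ≤ Real.cosh x := by
  rw [← Real.cosh_abs, Real.cosh_eq]
  linarith [Real.exp_pos (-|x|)]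

theorem exists_polynomial_growth_le_cosh (C : ℝ) (n : ℕ) {ε : ℝ} (hε : 0 < ε) :
    ∃ R : ℝ, 0 < R ∧ ∀ x : ℝ, R ≤ |x| → C * (1 + |x| ^ n) ≤ ε * Real.cosh x := by
  have h : Filter.Tendsto (fun y : ℝ => C * (y ^ 0 * Real.exp (-y) + y ^ n * Real.exp (-y)))
      Filter.atTop (nhds (C * (0 + 0))) :=
    ((Real.tendsto_pow_mul_exp_neg_atTop_nhds_zero 0).add
      (Real.tendsto_pow_mul_exp_neg_atTop_nhds_zero n)).const_mul C
  have hev := h.eventually_lt_const (show C * (0 + 0) < ε / 2 by simpa using hε)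
  obtain ⟨R, hR⟩ := Filter.eventually_atTop.1 hev
  refine ⟨max R 1, by positivity, fun x hx => ?_⟩
  have hlt := hR |x| ((le_max_left _ _).trans hx)
  have hexp : Real.exp (-|x|) * Real.exp |x| = 1 := by rw [← Real.exp_add]; simp
  have hle := mul_le_mul_of_nonneg_right hlt.le (Real.exp_pos |x|).le
  have heq : C * (|x| ^ 0 * Real.exp (-|x|) + |x| ^ n * Real.exp (-|x|)) * Real.exp |x|
      = C * (1 + |x| ^ n) := by
    linear_combination C * (1 + |x| ^ n) * hexp
  have := mul_le_mul_of_nonneg_left (half_exp_abs_le_cosh x) hε.le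
  linarith

/-- Comparison principle with the strict supersolution `ε e^{T-t} cosh x`. -/
theorem IsBackwardHeatSolution.le_exp_mul_cosh {T : ℝ} {W : ℝ → ℝ → ℝ}
    (hW : IsBackwardHeatSolution T W) {C : ℝ} {n : ℕ}
    (hgrowth : ∀ t ∈ Set.Icc 0 T, ∀ x : ℝ, W t x ≤ C * (1 + |x| ^ n))
    {ε : ℝ} (hε : 0 < ε) (hterm : ∀ x, W T x ≤ ε * Real.cosh x) :
    ∀ t ∈ Set.Icc 0 T, ∀ x, W t x ≤ ε * Real.exp (T - t) * Real.cosh x := by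
  intro t₀ ht₀ x₀
  by_contra! hlt
  obtain ⟨R, -, hR⟩ := exists_polynomial_growth_le_cosh C n hε
  obtain ⟨Wt, Wx, Wxx, hpde⟩ := hW.pde
  set h : ℝ → ℝ → ℝ := fun t x => ε * Real.exp (T - t) * Real.cosh x with hh
  have hcont : Continuous (fun p : ℝ × ℝ => W p.1 p.2 - h p.1 p.2) := by
    have := hW.continuous
    simp only [hh]
    fun_prop
  set M := max R |x₀| with hM
  have hx₀ : x₀ ∈ Set.Icc (-M) M := abs_le.1 (le_max_right _ _)
  obtain ⟨⟨t, x⟩, ⟨ht, hx⟩, hmax⟩ := (isCompact_Icc.prod isCompact_Icc).exists_isMaxOn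
    (s := Set.Icc 0 T ×ˢ Set.Icc (-M) M) ⟨(t₀, x₀), ht₀, hx₀⟩ hcont.continuousOn
  simp only at ht hx
  have hmax' : ∀ s ∈ Set.Icc 0 T, ∀ y ∈ Set.Icc (-M) M, W s y - h s y ≤ W t x - h t x :=
    fun s hs y hy => hmax (Set.mk_mem_prod hs hy)
  have hpos : 0 < W t x - h t x :=
    lt_of_lt_of_le (sub_pos.2 hlt) (hmax' t₀ ht₀ x₀ hx₀)
  have htT : t < T := by
    refine lt_of_le_of_ne ht.2 fun h' => ?_
    have := hterm x
    subst h'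
    simp only [hh, sub_self, Real.exp_zero, mul_one] at hpos
    linarith
  have hxR : |x| < R := by
    by_contra! hRx
    have h1 := hR x hRx
    have h2 := hgrowth t ht x
    have h3 : ε * Real.cosh x ≤ h t x := by
      have : 1 ≤ Real.exp (T - t) := Real.one_le_exp (by linarith)
      have := mul_le_mul_of_nonneg_left this (mul_pos hε (Real.cosh_pos x)).le
      simp only [hh]
      linarith
    linarith
  have hxM : |x| < M := hxR.trans_le (le_max_left _ _)
  obtain ⟨hWt, -, hWxx, heq⟩ := hpde t ⟨ht.1, htT⟩ x
  have hht : HasDerivAt (fun s => h s x) (-h t x) t := by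
    have := ((((hasDerivAt_id t).const_sub T).exp).const_mul ε).mul_const (Real.cosh x)
    exact this.congr_deriv (by simp only [hh, id]; ring)
  have hWle : Wt t x - -h t x ≤ 0 :=
    (hWt.sub hht).nonpos_of_le_right htT fun s hs => hmax' s ⟨ht.1.trans hs.1, hs.2⟩ x hx
  have hloc : IsLocalMax (fun y => W t y - h t y) x := by
    filter_upwards [Icc_mem_nhds (abs_lt.1 hxM).1 (abs_lt.1 hxM).2] with y hy
      using hmax' t ht y hy
  have hWxle : Wxx t x - h t x ≤ 0 :=
    hloc.secondDeriv_nonpos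
      (fun y => (hpde t ⟨ht.1, htT⟩ y).2.1.sub
        ((Real.hasDerivAt_cosh y).const_mul (ε * Real.exp (T - t))))
      (hWxx.sub ((Real.hasDerivAt_sinh x).const_mul (ε * Real.exp (T - t))))
  have hhpos : 0 < h t x := mul_pos (mul_pos hε (Real.exp_pos _)) (Real.cosh_pos x)
  linarith

theorem integral_cos_gaussianReal (v : NNReal) (b c : ℝ) :
    ∫ z, Real.cos (b * z + c) ∂(gaussianReal 0 v) = Real.exp (-(v * b ^ 2 / 2)) * Real.cos c := by
  have hint : Integrable (fun z : ℝ => Complex.exp (b * z * Complex.I) * Complex.exp (c * Complex.I))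
      (gaussianReal 0 v) := by
    refine Integrable.of_bound (C := 1) (by fun_prop) (Filter.Eventually.of_forall fun z => ?_)
    rw [← Complex.ofReal_mul, norm_mul, Complex.norm_exp_ofReal_mul_I,
      Complex.norm_exp_ofReal_mul_I, one_mul]
  have hre := integral_re hint
  rw [integral_mul_const, ← charFun_apply_real, charFun_gaussianReal] at hre
  have hl : ∀ z : ℝ, RCLike.re (Complex.exp (b * z * Complex.I) * Complex.exp (c * Complex.I))
      = Real.cos (b * z + c) := fun z => by
    rw [← Complex.exp_add, ← add_mul, ← Complex.ofReal_mul, ← Complex.ofReal_add]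
    exact Complex.exp_ofReal_mul_I_re _
  simp_rw [hl] at hre
  rw [hre]
  have : Complex.exp (b * (0 : ℝ) * Complex.I - v * b ^ 2 / 2)
      = ((Real.exp (-(v * b ^ 2 / 2)) : ℝ) : ℂ) := by
    push_cast
    congr 1
    ring
  rw [this]
  exact (Complex.re_ofReal_mul _ _).trans (by rw [Complex.exp_ofReal_mul_I_re])

theorem integrable_cosh_add_gaussianReal (v : NNReal) (x : ℝ) :
    Integrable (fun z => Real.cosh (x + z)) (gaussianReal 0 v) := by
  have h1 := (integrable_exp_mul_gaussianReal (μ := 0) (v := v) 1).const_mul (Real.exp x / 2)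
  have h2 := (integrable_exp_mul_gaussianReal (μ := 0) (v := v) (-1)).const_mul (Real.exp (-x) / 2)
  refine (h1.add h2).congr (Filter.Eventually.of_forall fun z => ?_)
  simp only [Pi.add_apply, Real.cosh_eq, neg_add, Real.exp_add, one_mul, neg_one_mul]
  ring

/-- The real trigonometric sums. -/
def trigSpan : Submodule ℝ (ℝ → ℝ) :=
  Submodule.span ℝ (Set.range fun p : ℝ × ℝ => fun x => Real.cos (p.1 * x + p.2))

theorem cos_mem_trigSpan (b c : ℝ) : (fun x => Real.cos (b * x + c)) ∈ trigSpan :=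
  Submodule.subset_span ⟨(b, c), rfl⟩

theorem mul_sin_mem_trigSpan (a : ℝ) {f : ℝ → ℝ} (hf : f ∈ trigSpan) :
    (fun x => f x * Real.sin (a * x)) ∈ trigSpan := by
  induction hf using Submodule.span_induction with
  | mem f hf =>
    obtain ⟨⟨b, c⟩, rfl⟩ := hf
    have h := trigSpan.sub_mem
      (trigSpan.smul_mem (1 / 2) (cos_mem_trigSpan (b + a) (c - Real.pi / 2)))
      (trigSpan.smul_mem (1 / 2) (cos_mem_trigSpan (b - a) (c - Real.pi / 2)))
    convert h using 1
    funext x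
    simp only [Pi.sub_apply, Pi.smul_apply, smul_eq_mul]
    rw [← add_sub_assoc, ← add_sub_assoc, Real.cos_sub_pi_div_two, Real.cos_sub_pi_div_two,
      show (b + a) * x + c = (b * x + c) + a * x by ring,
      show (b - a) * x + c = (b * x + c) - a * x by ring, Real.sin_add, Real.sin_sub]
    ring
  | zero => simp only [Pi.zero_apply, zero_mul]; exact trigSpan.zero_mem
  | add f g _ _ hf hg =>
    convert trigSpan.add_mem hf hg using 1
    funext x
    exact add_mul _ _ _
  | smul r f _ hf =>
    convert trigSpan.smul_mem r hf using 1
    funext x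
    exact mul_assoc _ _ _

theorem sin_pow_mem_trigSpan (a : ℝ) (n : ℕ) : (fun x => Real.sin (a * x) ^ n) ∈ trigSpan := by
  induction n with
  | zero => simpa using cos_mem_trigSpan 0 0
  | succ n ih => simpa only [pow_succ] using mul_sin_mem_trigSpan a ih

theorem eval_sin_mem_trigSpan (a : ℝ) (p : Polynomial ℝ) :
    (fun x => p.eval (Real.sin (a * x))) ∈ trigSpan := by
  induction p using Polynomial.induction_on' with
  | add p q hp hq => simp only [Polynomial.eval_add]; exact trigSpan.add_mem hp hq
  | monomial n r =>
    simp only [Polynomial.eval_monomial]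
    exact trigSpan.smul_mem r (sin_pow_mem_trigSpan a n)

theorem exists_trigSpan_near {f : ℝ → ℝ} (hf : Continuous f) {C : ℝ} {n : ℕ}
    (hgrowth : ∀ x, |f x| ≤ C * (1 + |x| ^ n)) {ε : ℝ} (hε : 0 < ε) :
    ∃ q ∈ trigSpan, ∀ x, |f x - q x| ≤ ε * Real.cosh x := by
  obtain ⟨R, hR, hRC⟩ := exists_polynomial_growth_le_cosh C n (show 0 < ε / 4 by positivity)
  have hC : 0 ≤ C := by
    have := (abs_nonneg _).trans (hgrowth 0)
    exact nonneg_of_mul_nonneg_left this (by positivity)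
  have hpi := Real.pi_pos
  set a := Real.pi / 2 / R with ha
  have ha0 : 0 < a := by positivity
  have haR : a * R = Real.pi / 2 := by rw [ha]; field_simp
  obtain ⟨p, hp⟩ := exists_polynomial_near_of_continuousOn (-1) 1
    (fun s => f (Real.arcsin s / a))
    (hf.comp (Real.continuous_arcsin.div_const a)).continuousOn (ε / 2) (by positivity)
  refine ⟨_, eval_sin_mem_trigSpan a p, fun x => ?_⟩
  have hpx := hp (Real.sin (a * x)) (Real.sin_mem_Icc _)
  rw [abs_sub_comm] at hpx
  set y := Real.arcsin (Real.sin (a * x)) / a with hy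
  have hcosh := mul_le_mul_of_nonneg_left (Real.one_le_cosh x) hε.le
  have hfy : |f x - f y| ≤ ε / 2 * Real.cosh x := by
    rcases le_total |x| R with hx | hx
    · have hax := mul_le_mul_of_nonneg_left (abs_le.1 hx).1 ha0.le
      have hax' := mul_le_mul_of_nonneg_left (abs_le.1 hx).2 ha0.le
      have hyx : y = x := by
        rw [hy, Real.arcsin_sin (by linarith) (by linarith)]
        field_simp
      rw [hyx, sub_self, abs_zero]
      linarith
    · have hyR : |y| ≤ |x| := by
        refine le_trans ?_ hx
        rw [hy, abs_div, abs_of_pos ha0, div_le_iff₀ ha0, mul_comm R, haR]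
        exact abs_le.2 ⟨Real.neg_pi_div_two_le_arcsin _, Real.arcsin_le_pi_div_two _⟩
      have h1 : C * (1 + |y| ^ n) ≤ C * (1 + |x| ^ n) := by gcongr
      have := abs_sub (f x) (f y)
      linarith [hRC x hx, hgrowth x, hgrowth y]
  have := abs_sub_le (f x) (f y) (p.eval (Real.sin (a * x)))
  linarith

theorem exists_isBackwardHeatSolution_of_mem_trigSpan (T : ℝ) {q : ℝ → ℝ} (hq : q ∈ trigSpan) :
    Continuous q ∧ (∃ C, ∀ x, |q x| ≤ C) ∧ ∃ Q : ℝ → ℝ → ℝ, IsBackwardHeatSolution T Q ∧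
      ∀ t ≤ T, ∀ x, Q t x = ∫ z, q (x + z) ∂(gaussianReal 0 (T - t).toNNReal) := by
  induction hq using Submodule.span_induction with
  | mem f hf =>
    obtain ⟨⟨b, c⟩, rfl⟩ := hf
    simp only
    refine ⟨by fun_prop, ⟨1, fun x => Real.abs_cos_le_one _⟩,
      fun t x => Real.exp (-((T - t) * b ^ 2 / 2)) * Real.cos (b * x + c),
      ⟨by fun_prop,
        fun t x => b ^ 2 / 2 * (Real.exp (-((T - t) * b ^ 2 / 2)) * Real.cos (b * x + c)),
        fun t x => Real.exp (-((T - t) * b ^ 2 / 2)) * (-Real.sin (b * x + c) * b),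
        fun t x => Real.exp (-((T - t) * b ^ 2 / 2)) * (-(Real.cos (b * x + c) * b) * b),
        fun t _ x => ?_⟩, fun t ht x => ?_⟩
    · have hl : HasDerivAt (fun y => b * y + c) b x := by
        simpa using ((hasDerivAt_id x).const_mul b).add_const c
      refine ⟨?_, hl.cos.const_mul _, (hl.sin.neg.mul_const b).const_mul _, by ring⟩
      have := ((((((hasDerivAt_id t).const_sub T).mul_const (b ^ 2)).div_const 2).neg).exp).mul_const
        (Real.cos (b * x + c))
      exact this.congr_deriv (by simp only [Pi.neg_apply, id]; ring)
    · have := integral_cos_gaussianReal (T - t).toNNReal b (b * x + c)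
      rw [Real.coe_toNNReal _ (sub_nonneg.2 ht)] at this
      refine this.symm.trans ?_
      congr 1
      funext z
      congr 1
      ring
  | zero =>
    refine ⟨continuous_const, ⟨0, by simp⟩, fun _ _ => 0,
      ⟨continuous_const, fun _ _ => 0, fun _ _ => 0, fun _ _ => 0, fun t _ x => ?_⟩, by simp⟩
    exact ⟨hasDerivAt_const _ _, hasDerivAt_const _ _, hasDerivAt_const _ _, by simp⟩
  | add f g _ _ hf hg =>
    obtain ⟨hfc, ⟨A, hA⟩, P, hP, hPf⟩ := hf
    obtain ⟨hgc, ⟨B, hB⟩, Q, hQ, hQg⟩ := hg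
    refine ⟨hfc.add hgc, ⟨A + B, fun x => (abs_add_le _ _).trans (add_le_add (hA x) (hB x))⟩,
      _, hP.add hQ, fun t ht x => ?_⟩
    simp only [Pi.add_apply]
    rw [hPf t ht, hQg t ht, integral_add]
    · exact Integrable.of_bound (C := A) (by fun_prop) (Filter.Eventually.of_forall fun z => hA _)
    · exact Integrable.of_bound (C := B) (by fun_prop) (Filter.Eventually.of_forall fun z => hB _)
  | smul r f _ hf =>
    obtain ⟨hfc, ⟨A, hA⟩, P, hP, hPf⟩ := hf
    refine ⟨hfc.const_smul r, ⟨|r| * A, fun x => ?_⟩, _, hP.const_mul r, fun t ht x => ?_⟩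
    · rw [Pi.smul_apply, smul_eq_mul, abs_mul]
      exact mul_le_mul_of_nonneg_left (hA x) (abs_nonneg r)
    · simp only [Pi.smul_apply, smul_eq_mul]
      rw [hPf t ht, integral_const_mul]

theorem IsBackwardHeatSolution.eq_integral_gaussianReal {T : ℝ} {F : ℝ → ℝ → ℝ}
    (hF : IsBackwardHeatSolution T F) {C : ℝ} {n : ℕ}
    (hgrowth : ∀ t ∈ Set.Icc 0 T, ∀ x : ℝ, |F t x| ≤ C * (1 + |x| ^ n))
    {t : ℝ} (ht : t ∈ Set.Icc 0 T) (x : ℝ) :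
    F t x = ∫ z, F T (x + z) ∂(gaussianReal 0 (T - t).toNNReal) := by
  set γ := gaussianReal 0 (T - t).toNNReal with hγ
  have hT : T ∈ Set.Icc 0 T := ⟨ht.1.trans ht.2, le_rfl⟩
  have hFT : Continuous (F T) := hF.continuous.comp (Continuous.prodMk_right T)
  have hcosh := integrable_cosh_add_gaussianReal (T - t).toNNReal x
  set K := Real.exp (T - t) * Real.cosh x + ∫ z, Real.cosh (x + z) ∂γ with hK
  have hKpos : 0 < K := add_pos_of_pos_of_nonneg (mul_pos (Real.exp_pos _) (Real.cosh_pos x))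
    (integral_nonneg fun z => (Real.cosh_pos _).le)
  have key : ∀ ε > 0, |F t x - ∫ z, F T (x + z) ∂γ| ≤ ε * K := by
    intro ε hε
    obtain ⟨q, hq, hqF⟩ := exists_trigSpan_near hFT (hgrowth T hT) hε
    obtain ⟨hqc, ⟨B, hB⟩, Q, hQ, hQq⟩ := exists_isBackwardHeatSolution_of_mem_trigSpan T hq
    have hB0 : 0 ≤ B := (abs_nonneg _).trans (hB 0)
    have hQB : ∀ s ≤ T, ∀ y, |Q s y| ≤ B := by
      intro s hs y
      rw [hQq s hs]
      have := norm_integral_le_of_norm_le_const (μ := gaussianReal 0 (T - s).toNNReal)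
        (f := fun z => q (y + z)) (C := B)
        (Filter.Eventually.of_forall fun z => hB (y + z))
      simpa using this
    have hQT : ∀ y, Q T y = q y := fun y => by simp [hQq T le_rfl]
    have hbound : ∀ s ∈ Set.Icc 0 T, ∀ y, |F s y| + |Q s y| ≤ (C + B) * (1 + |y| ^ n) := by
      intro s hs y
      have := hgrowth s hs y
      have := hQB s hs.2 y
      have : 0 ≤ B * |y| ^ n := by positivity
      linarith
    have h1 := (hF.add (hQ.const_mul (-1))).le_exp_mul_cosh (C := C + B) (n := n)
      (fun s hs y => by
        linarith [hbound s hs y, le_abs_self (F s y), neg_abs_le (Q s y)]) hε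
      (fun y => by linarith [hQT y, (abs_le.1 (hqF y)).2]) t ht x
    have h2 := ((hF.const_mul (-1)).add hQ).le_exp_mul_cosh (C := C + B) (n := n)
      (fun s hs y => by
        linarith [hbound s hs y, neg_abs_le (F s y), le_abs_self (Q s y)]) hε
      (fun y => by linarith [hQT y, (abs_le.1 (hqF y)).1]) t ht x
    have hqi : Integrable (fun z => q (x + z)) γ :=
      Integrable.of_bound (C := B) (by fun_prop) (Filter.Eventually.of_forall fun z => hB _)
    have hdi : Integrable (fun z => F T (x + z) - q (x + z)) γ :=
      (hcosh.const_mul ε).mono' (by fun_prop) (Filter.Eventually.of_forall fun z => hqF _)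
    have hFi : Integrable (fun z => F T (x + z)) γ := 
      (hdi.add hqi).congr (Filter.Eventually.of_forall fun z => sub_add_cancel _ _)
    have h3 : |(∫ z, F T (x + z) ∂γ) - Q t x| ≤ ε * ∫ z, Real.cosh (x + z) ∂γ := by
      rw [hQq t ht.2, ← integral_sub hFi hqi, ← integral_const_mul]
      exact norm_integral_le_of_norm_le (f := fun z => F T (x + z) - q (x + z)) (hcosh.const_mul ε)
        (Filter.Eventually.of_forall fun z => hqF _)
    rw [hK, mul_add, ← mul_assoc]
    have h3' := abs_le.1 h3
    exact abs_le.2 ⟨by linarith, by linarith⟩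
  refine sub_eq_zero.1 (abs_nonpos_iff.1 (le_of_forall_pos_le_add fun δ hδ => ?_))
  have := key (δ / K) (div_pos hδ hKpos)
  rwa [div_mul_cancel₀ _ hKpos.ne', ← zero_add δ] at this

/-- A continuous, polynomially bounded solution of the backward heat equation
`∂_t F + (1/2)∂_{xx}F = 0` on `[0,T] × ℝ` with terminal condition `F(T,·) = F_T` is given
by Gaussian convolution: `F(t,x) = ∫ F_T(x+z) R_{T−t}(z) dz` for `t ∈ [0,T)`. -/
theorem backward_heat_representation (T : ℝ) (hT : 0 < T)
    (F Ft Fx Fxx : ℝ → ℝ → ℝ) (FT : ℝ → ℝ)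
    (hcont : Continuous (fun p : ℝ × ℝ => F p.1 p.2))
    (hgrowth : ∃ C : ℝ, ∃ n : ℕ, ∀ t ∈ Set.Icc 0 T, ∀ x : ℝ, |F t x| ≤ C * (1 + |x|^n))
    (hFt : ∀ t ∈ Set.Ico 0 T, ∀ x : ℝ, HasDerivAt (fun s => F s x) (Ft t x) t)
    (hFx : ∀ t ∈ Set.Ico 0 T, ∀ x : ℝ, HasDerivAt (fun y => F t y) (Fx t x) x)
    (hFxx : ∀ t ∈ Set.Ico 0 T, ∀ x : ℝ, HasDerivAt (fun y => Fx t y) (Fxx t x) x)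
    (hpde : ∀ t ∈ Set.Ico 0 T, ∀ x : ℝ, Ft t x + (1/2) * Fxx t x = 0)
    (hterm : ∀ x : ℝ, F T x = FT x) :
    ∀ t ∈ Set.Ico 0 T, ∀ x : ℝ,
      F t x = ∫ z : ℝ, FT (x + z) * gaussianPDFReal 0 (Real.toNNReal (T - t)) z := by
  intro t ht x
  obtain ⟨C, n, hC⟩ := hgrowth
  have hF : IsBackwardHeatSolution T F := ⟨hcont, Ft, Fx, Fxx, fun s hs y =>
    ⟨hFt s hs y, hFx s hs y, hFxx s hs y, hpde s hs y⟩⟩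
  rw [hF.eq_integral_gaussianReal hC ⟨ht.1, ht.2.le⟩ x, integral_gaussianReal_eq_integral_smul
    (Real.toNNReal_pos.2 (sub_pos.2 ht.2)).ne']
  simp only [smul_eq_mul, hterm, mul_comm]
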